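/- Any hypergraph H of degree exactly 2 is isomorphic to the tree-witness hypergraph H_{Q_H} of the associated OMQ Q_H = (T, q) with ontology of depth 1, via the map sending a vertex v to the atom R_v(z_{i₁(v)}, z_{i₂(v)}) and a hyperedge e to the tree witness t^e with internal variable z_e. -/

import Mathlib

/-- A role: a binary predicate together with a direction (`true` = the predicate itself,
`false` = its inverse). -/
abbrev DLRole (BP : Type) := BP × Bool

/-- The inverse of a role. -/
def DLRole.inv {BP : Type} (ρ : DLRole BP) : DLRole BP := (ρ.1, !ρ.2)

/-- OWL 2 QL concepts: `⊤`, unary predicates `A(x)`, and `∃y ρ(x,y)`. -/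
inductive DLConcept (UP BP : Type) where
  | top : DLConcept UP BP
  | atm : UP → DLConcept UP BP
  | ex : DLRole BP → DLConcept UP BP

/-- (The positive part of) an OWL 2 QL ontology: concept inclusions `τ(x) → τ'(x)`, role
inclusions `ρ(x,y) → ρ'(x,y)` and reflexivity axioms `∀x ρ(x,x)`. -/
structure DLOnt (UP BP : Type) where
  ci : Set (DLConcept UP BP × DLConcept UP BP)
  ri : Set (DLRole BP × DLRole BP)
  refl : Set (DLRole BP)

/-- A first-order interpretation of the signature. -/
structure DLInterp (UP BP : Type) where
  Dom : Type
  iu : UP → Set Dom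
  ib : BP → Set (Dom × Dom)

/-- The extension of a role in an interpretation. -/
def DLInterp.role {UP BP : Type} (I : DLInterp UP BP) (ρ : DLRole BP) :
    Set (I.Dom × I.Dom) :=
  if ρ.2 then I.ib ρ.1 else {p | (p.2, p.1) ∈ I.ib ρ.1}

/-- The extension of a concept in an interpretation. -/
def DLInterp.conc {UP BP : Type} (I : DLInterp UP BP) : DLConcept UP BP → Set I.Dom
  | .top => Set.univ
  | .atm A => I.iu A
  | .ex ρ => {d | ∃ d', (d, d') ∈ I.role ρ}

/-- An interpretation is a model of an ontology. -/
def DLInterp.IsModel {UP BP : Type} (I : DLInterp UP BP) (T : DLOnt UP BP) : Prop :=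
  (∀ p ∈ T.ci, I.conc p.1 ⊆ I.conc p.2) ∧
  (∀ p ∈ T.ri, I.role p.1 ⊆ I.role p.2) ∧
  (∀ ρ ∈ T.refl, ∀ d : I.Dom, (d, d) ∈ I.role ρ)

/-- `T ⊨ τ(x) → τ'(x)`. -/
def DLOnt.Sub {UP BP : Type} (T : DLOnt UP BP) (c d : DLConcept UP BP) : Prop :=
  ∀ I : DLInterp UP BP, I.IsModel T → I.conc c ⊆ I.conc d

/-- `T ⊨ ρ(x,y) → σ(x,y)`. -/
def DLOnt.RSub {UP BP : Type} (T : DLOnt UP BP) (ρ σ : DLRole BP) : Prop :=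
  ∀ I : DLInterp UP BP, I.IsModel T → I.role ρ ⊆ I.role σ

/-- `T ⊨ ∀x ρ(x,x)`. -/
def DLOnt.ReflE {UP BP : Type} (T : DLOnt UP BP) (ρ : DLRole BP) : Prop :=
  ∀ I : DLInterp UP BP, I.IsModel T → ∀ d : I.Dom, (d, d) ∈ I.role ρ

/-- `T ⊨ τ(x) → ρ(x,x)`. -/
def DLOnt.Loop {UP BP : Type} (T : DLOnt UP BP) (τ : DLConcept UP BP)
    (ρ : DLRole BP) : Prop :=
  ∀ I : DLInterp UP BP, I.IsModel T → ∀ d ∈ I.conc τ, (d, d) ∈ I.role ρ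

/-- The labelled nulls of the canonical model `C_T^{τ(a)}`: words `ρ₁ ⋯ ρₙ` such that
`T ⊨ τ(x) → ∃y ρ₁(x,y)` but `T, τ(a) ⊭ ρ₁(a,a)`, no `ρᵢ` is entailed reflexive, and
`T ⊨ (∃x ρᵢ(x,y)) → ∃z ρᵢ₊₁(y,z)` but `T ⊭ ρᵢ(y,x) → ρᵢ₊₁(x,y)`.  The empty word denotes
the individual `a`. -/
def GenWord {UP BP : Type} (T : DLOnt UP BP) (τ : DLConcept UP BP)
    (w : List (DLRole BP)) : Prop :=
  (∀ ρ ∈ w, ¬ T.ReflE ρ) ∧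
  (∀ ρ rest, w = ρ :: rest → T.Sub τ (.ex ρ) ∧ ¬ T.Loop τ ρ) ∧
  (∀ i : ℕ, ∀ h : i + 1 < w.length,
      T.Sub (.ex (DLRole.inv (w.get ⟨i, Nat.lt_of_succ_lt h⟩))) (.ex (w.get ⟨i + 1, h⟩)) ∧
      ¬ T.RSub (DLRole.inv (w.get ⟨i, Nat.lt_of_succ_lt h⟩)) (w.get ⟨i + 1, h⟩))

/-- Membership of an element of `C_T^{τ(a)}` in a unary predicate. -/
def CMu {UP BP : Type} (T : DLOnt UP BP) (τ : DLConcept UP BP) (A : UP)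
    (w : List (DLRole BP)) : Prop :=
  (w = [] ∧ T.Sub τ (.atm A)) ∨
  (∃ w' ρ, w = w' ++ [ρ] ∧ T.Sub (.ex (DLRole.inv ρ)) (.atm A))

/-- Membership of a pair of elements of `C_T^{τ(a)}` in a binary predicate. -/
def CMb {UP BP : Type} (T : DLOnt UP BP) (τ : DLConcept UP BP) (P : BP)
    (u v : List (DLRole BP)) : Prop :=
  (u = [] ∧ v = [] ∧ T.Loop τ (P, true)) ∨
  (u = v ∧ T.ReflE (P, true)) ∨
  (∃ ρ, v = u ++ [ρ] ∧ T.RSub ρ (P, true)) ∨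
  (∃ ρ, u = v ++ [ρ] ∧ T.RSub ρ (P, false))

/-- Atoms of a conjunctive query: `A(x)` and `P(x,y)`. -/
inductive QAtom (UP BP V : Type) where
  | ua : UP → V → QAtom UP BP V
  | ba : BP → V → V → QAtom UP BP V
deriving DecidableEq

/-- The variables of an atom. -/
def QAtom.vars {UP BP V : Type} [DecidableEq V] : QAtom UP BP V → Finset V
  | .ua _ x => {x}
  | .ba _ x y => {x, y}

/-- The variables of a CQ. -/
def qvars {UP BP V : Type} [DecidableEq V] (q : Finset (QAtom UP BP V)) : Finset V :=
  q.biUnion QAtom.vars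

/-- `q_t`: the atoms of `q` all of whose variables are in `t_r ∪ t_i` and at least one of
whose variables is in `t_i`. -/
def qtw {UP BP V : Type} [DecidableEq UP] [DecidableEq BP] [DecidableEq V]
    (q : Finset (QAtom UP BP V)) (tr ti : Finset V) : Finset (QAtom UP BP V) :=
  q.filter fun a => a.vars ⊆ tr ∪ ti ∧ ¬ a.vars ⊆ tr

/-- `h` is a homomorphism from the set `S` of atoms to the canonical model `C_T^{τ(a)}`. -/
def HomOn {UP BP V : Type} [DecidableEq V] (T : DLOnt UP BP) (τ : DLConcept UP BP)
    (S : Finset (QAtom UP BP V)) (h : V → List (DLRole BP)) : Prop :=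
  (∀ v ∈ qvars S, GenWord T τ (h v)) ∧
  (∀ a ∈ S,
    (∀ A x, a = QAtom.ua A x → CMu T τ A (h x)) ∧
    (∀ P x y, a = QAtom.ba P x y → CMb T τ P (h x) (h y)))

/-- `(t_r, t_i)` is a candidate tree witness for the OMQ `(T, q)` with answer variables
`ans`: disjoint sets of variables of `q`, `t_i` nonempty and without answer variables,
`q_t` contains every atom of `q` with a variable in `t_i`, and there is a concept `τ` and a
homomorphism `h : q_t → C_T^{τ(a)}` with `t_r = h⁻¹(a)`. -/
def IsPreTW {UP BP V : Type} [DecidableEq UP] [DecidableEq BP] [DecidableEq V]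
    (T : DLOnt UP BP) (q : Finset (QAtom UP BP V)) (ans : Finset V)
    (tr ti : Finset V) : Prop :=
  Disjoint tr ti ∧ ti.Nonempty ∧ Disjoint ti ans ∧ tr ∪ ti ⊆ qvars q ∧
  (∀ a ∈ q, ¬ Disjoint a.vars ti → a ∈ qtw q tr ti) ∧
  ∃ (τ : DLConcept UP BP) (h : V → List (DLRole BP)),
    HomOn T τ (qtw q tr ti) h ∧
    tr ⊆ qvars (qtw q tr ti) ∧
    (∀ v ∈ qvars (qtw q tr ti), (h v = [] ↔ v ∈ tr))

/-- A tree witness: a candidate tree witness whose `q_t` is minimal (no candidate tree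
witness has a strictly smaller set of internal variables). -/
def IsTW {UP BP V : Type} [DecidableEq UP] [DecidableEq BP] [DecidableEq V]
    (T : DLOnt UP BP) (q : Finset (QAtom UP BP V)) (ans : Finset V)
    (tr ti : Finset V) : Prop :=
  IsPreTW T q ans tr ti ∧
  ∀ tr' ti' : Finset V, IsPreTW T q ans tr' ti' → ti' ⊆ ti → ti' = ti

/-- The ontology `T` is of depth `k`: no role is entailed reflexive, some canonical model
`C_T^{τ(a)}` contains a word of length `k`, and none contains a longer word. -/
def HasDepth {UP BP : Type} (T : DLOnt UP BP) (k : ℕ) : Prop :=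
  (∀ ρ : DLRole BP, ¬ T.ReflE ρ) ∧
  (∃ (τ : DLConcept UP BP) (w : List (DLRole BP)), GenWord T τ w ∧ w.length = k) ∧
  (∀ (τ : DLConcept UP BP) (w : List (DLRole BP)), GenWord T τ w → w.length ≤ k)

section QH

variable {Vx Ex : Type} [Fintype Vx] [Fintype Ex] [DecidableEq Vx] [DecidableEq Ex]

/-- The (normalised) ontology of the OMQ `Q_H` associated with a degree-2 hypergraph `H`
given by incidence maps `i1, i2 : V → E`: for each hyperedge `e` it contains the axioms
`A_e(x) → ∃y P_e(x,y)`, `P_e(x,y) → R_v(y,x)` for `i1 v = e`, and `P_e(x,y) → R_v(x,y)`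
for `i2 v = e` (which normalise `A_e(x) → ∃y (⋀_{i1 v = e} R_v(y,x) ∧ ⋀_{i2 v = e}
R_v(x,y))`);  unary predicates are the `A_e`, and binary predicates are the `R_v`
(`Sum.inl`) and the normalisation predicates `P_e` (`Sum.inr`). -/
def QH.T (i1 i2 : Vx → Ex) : DLOnt Ex (Vx ⊕ Ex) where
  ci := {p | ∃ e : Ex, p = (DLConcept.atm e, DLConcept.ex (Sum.inr e, true))}
  ri := {p | ∃ v : Vx, p = ((Sum.inr (i1 v), true), (Sum.inl v, false)) ∨
                       p = ((Sum.inr (i2 v), true), (Sum.inl v, true))}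
  refl := ∅

/-- The map sending a vertex `v` of `H` to the atom `R_v(z_{i1 v}, z_{i2 v})` (the CQ
variables `z_e` are the hyperedges `e`). -/
def QH.g (i1 i2 : Vx → Ex) : Vx → QAtom Ex (Vx ⊕ Ex) Ex :=
  fun v => QAtom.ba (Sum.inl v) (i1 v) (i2 v)

/-- The Boolean CQ `q = { R_v(z_{i1 v}, z_{i2 v}) : v ∈ V }` of the OMQ `Q_H`. -/
def QH.q (i1 i2 : Vx → Ex) : Finset (QAtom Ex (Vx ⊕ Ex) Ex) :=
  Finset.univ.image (QH.g i1 i2)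

/-- The image under `QH.g` of the hyperedge `e` (the set of vertices incident to `e`). -/
def QH.gE (i1 i2 : Vx → Ex) (e : Ex) : Finset (QAtom Ex (Vx ⊕ Ex) Ex) :=
  (Finset.univ.filter fun v : Vx => i1 v = e ∨ i2 v = e).image (QH.g i1 i2)

/-- Interpretation with two elements, related exactly when different. -/
def QHaux.I : DLInterp Ex (Vx ⊕ Ex) where
  Dom := Bool
  iu := fun _ => Set.univ
  ib := fun _ => {p | p.1 ≠ p.2}

theorem QHaux.role (ρ : DLRole (Vx ⊕ Ex)) (a b : Bool) :
    ((a, b) ∈ (QHaux.I (Vx := Vx) (Ex := Ex)).role ρ) ↔ a ≠ b := by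
  unfold DLInterp.role
  split
  · exact Iff.rfl
  · exact ne_comm

theorem QHaux.model (i1 i2 : Vx → Ex) :
    (QHaux.I (Vx := Vx) (Ex := Ex)).IsModel (QH.T i1 i2) := by
  refine ⟨?_, ?_, ?_⟩
  · rintro p ⟨e, rfl⟩ d _
    exact ⟨!d, (QHaux.role _ _ _).2 (by cases d <;> decide)⟩
  · rintro p _ ⟨a, b⟩ h
    exact (QHaux.role _ _ _).2 ((QHaux.role _ _ _).1 h)
  · rintro ρ h
    exact h.elim

theorem QHaux.gen (i1 i2 : Vx → Ex) (e : Ex) :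
    GenWord (QH.T i1 i2) (.atm e) [(Sum.inr e, true)] := by
  refine ⟨?_, ?_, ?_⟩
  · intro ρ _ h
    exact (QHaux.role _ _ _).1 (h _ (QHaux.model i1 i2) true) rfl
  · rintro ρ rest h
    obtain ⟨rfl, rfl⟩ := List.cons.inj h
    refine ⟨fun I hI => hI.1 _ ⟨e, rfl⟩, fun h => ?_⟩
    exact (QHaux.role _ _ _).1 (h _ (QHaux.model i1 i2) true trivial) rfl
  · intro i h
    simp at h

theorem QHaux.qtw_eq (i1 i2 : Vx → Ex) (tr : Finset Ex) (e : Ex) (he : e ∉ tr)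
    (h : ∀ v, i1 v = e ∨ i2 v = e → (i1 v ∈ tr ∨ i1 v = e) ∧ (i2 v ∈ tr ∨ i2 v = e)) :
    qtw (QH.q i1 i2) tr {e} = QH.gE i1 i2 e := by
  ext a
  simp only [qtw, QH.q, QH.gE, Finset.mem_filter, Finset.mem_image, Finset.mem_univ, true_and]
  constructor
  · rintro ⟨⟨v, rfl⟩, h1, h2⟩
    refine ⟨v, ?_, rfl⟩
    simp only [QH.g, QAtom.vars, Finset.insert_subset_iff, Finset.singleton_subset_iff,
      Finset.mem_union, Finset.mem_singleton] at h1 h2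
    tauto
  · rintro ⟨v, hv, rfl⟩
    refine ⟨⟨v, rfl⟩, ?_⟩
    have := h v hv
    simp only [QH.g, QAtom.vars, Finset.insert_subset_iff, Finset.singleton_subset_iff,
      Finset.mem_union, Finset.mem_singleton]
    refine ⟨this, fun h2 => ?_⟩
    rcases hv with rfl | rfl
    · exact he h2.1
    · exact he h2.2

theorem QHaux.pre (i1 i2 : Vx → Ex) (hi : ∀ v, i1 v ≠ i2 v)
    (hne : ∀ e : Ex, ∃ v, i1 v = e ∨ i2 v = e) (e : Ex) :
    ∃ tr : Finset Ex, IsPreTW (QH.T i1 i2) (QH.q i1 i2) (∅ : Finset Ex) tr {e} ∧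
      qtw (QH.q i1 i2) tr {e} = QH.gE i1 i2 e := by
  classical
  let tr : Finset Ex := Finset.univ.filter fun e' =>
    e' ≠ e ∧ ∃ v, (i1 v = e ∧ i2 v = e') ∨ (i1 v = e' ∧ i2 v = e)
  have htr : ∀ x, x ∈ tr ↔ x ≠ e ∧ ∃ v, (i1 v = e ∧ i2 v = x) ∨ (i1 v = x ∧ i2 v = e) := by
    intro x; simp [tr]
  have he : e ∉ tr := fun h => ((htr e).1 h).1 rfl
  have hq : qtw (QH.q i1 i2) tr {e} = QH.gE i1 i2 e := by
    apply QHaux.qtw_eq i1 i2 tr e he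
    rintro v (hv | hv)
    · exact ⟨.inr hv, .inl ((htr _).2 ⟨fun h => hi v (hv.trans h.symm), v, .inl ⟨hv, rfl⟩⟩)⟩
    · exact ⟨.inl ((htr _).2 ⟨fun h => hi v (h.trans hv.symm), v, .inr ⟨rfl, hv⟩⟩), .inr hv⟩
  have hmem : ∀ x, x ∈ qvars (QH.gE i1 i2 e) ↔
      ∃ v, (i1 v = e ∨ i2 v = e) ∧ (x = i1 v ∨ x = i2 v) := by
    intro x
    simp [qvars, QH.gE, QH.g, QAtom.vars]
  refine ⟨tr, ⟨?_, Finset.singleton_nonempty e, Finset.disjoint_empty_right _, ?_, ?_,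
    .atm e, fun x => if x = e then [(Sum.inr e, true)] else [], ⟨?_, ?_⟩, ?_, ?_⟩, hq⟩
  · exact Finset.disjoint_singleton_right.2 he
  · intro x _
    obtain ⟨v, hv⟩ := hne x
    simp only [qvars, QH.q, Finset.mem_biUnion, Finset.mem_image, Finset.mem_univ, true_and]
    refine ⟨_, ⟨v, rfl⟩, ?_⟩
    simp only [QH.g, QAtom.vars, Finset.mem_insert, Finset.mem_singleton]
    exact hv.imp Eq.symm Eq.symm
  · intro a ha hd
    rw [hq]
    simp only [QH.q, Finset.mem_image, Finset.mem_univ, true_and] at ha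
    obtain ⟨v, rfl⟩ := ha
    simp only [QH.g, QAtom.vars, Finset.disjoint_singleton_right, Finset.mem_insert,
      Finset.mem_singleton, not_not] at hd
    simp only [QH.gE, Finset.mem_image, Finset.mem_filter, Finset.mem_univ, true_and]
    exact ⟨v, hd.imp Eq.symm Eq.symm, rfl⟩
  · intro x _
    by_cases hx : x = e
    · simp only [hx, if_true]
      exact QHaux.gen i1 i2 e
    · simp only [hx, if_false]
      exact ⟨by simp, by simp, by simp⟩
  · intro a ha
    rw [hq] at ha
    simp only [QH.gE, Finset.mem_image, Finset.mem_filter, Finset.mem_univ, true_and] at ha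
    obtain ⟨v, hv, rfl⟩ := ha
    refine ⟨fun A x h => by simp [QH.g] at h, fun P x y h => ?_⟩
    simp only [QH.g, QAtom.ba.injEq] at h
    obtain ⟨rfl, rfl, rfl⟩ := h
    rcases hv with hv | hv
    · have h2 : i2 v ≠ e := fun h => hi v (hv.trans h.symm)
      right; right; right
      refine ⟨(Sum.inr e, true), by simp [hv, h2], fun I hI => hI.2.1 ((Sum.inr e, true), (Sum.inl v, false)) ⟨v, .inl ?_⟩⟩
      rw [hv]
    · have h2 : i1 v ≠ e := fun h => hi v (h.trans hv.symm)
      right; right; left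
      refine ⟨(Sum.inr e, true), by simp [hv, h2], fun I hI => hI.2.1 ((Sum.inr e, true), (Sum.inl v, true)) ⟨v, .inr ?_⟩⟩
      rw [hv]
  · intro x hx
    rw [hq, hmem]
    obtain ⟨_, v, ⟨h1, h2⟩ | ⟨h1, h2⟩⟩ := (htr x).1 hx
    · exact ⟨v, .inl h1, .inr h2.symm⟩
    · exact ⟨v, .inr h2, .inl h1.symm⟩
  · intro x hx
    rw [hq, hmem] at hx
    rw [htr]
    by_cases hxe : x = e
    · simp [hxe]
    · simp only [hxe, if_false, true_iff]
      refine ⟨hxe, ?_⟩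
      obtain ⟨v, hv, hx⟩ := hx
      refine ⟨v, ?_⟩
      rcases hv with hv | hv <;> rcases hx with rfl | rfl
      · exact (hxe hv).elim
      · exact .inl ⟨hv, rfl⟩
      · exact .inr ⟨rfl, hv⟩
      · exact (hxe hv).elim

/-- Any hypergraph `H` of degree exactly 2 (given by incidence maps
`i1, i2 : V → E` with `i1 v ≠ i2 v`, hyperedges nonempty and distinct hyperedges having
distinct vertex sets) is isomorphic to the tree-witness hypergraph `H_{Q_H}` of the
associated OMQ `Q_H = (T, q)` with ontology of depth 1, via the map sending a vertex `v`
to the atom `R_v(z_{i1 v}, z_{i2 v})` and a hyperedge `e` to the tree witness `t^e` with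
internal variable `z_e`. -/
theorem stmt_16 (i1 i2 : Vx → Ex) (hi : ∀ v, i1 v ≠ i2 v)
    (hne : ∀ e : Ex, ∃ v, i1 v = e ∨ i2 v = e)
    (hsets : ∀ e e' : Ex,
      (Finset.univ.filter fun v : Vx => i1 v = e ∨ i2 v = e) =
        (Finset.univ.filter fun v : Vx => i1 v = e' ∨ i2 v = e') → e = e') :
    Function.Injective (QH.g i1 i2) ∧
    (∀ e : Ex, ∃ tr : Finset Ex,
      IsTW (QH.T i1 i2) (QH.q i1 i2) (∅ : Finset Ex) tr {e} ∧
      qtw (QH.q i1 i2) tr {e} = QH.gE i1 i2 e) ∧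
    (∀ tr ti : Finset Ex, IsTW (QH.T i1 i2) (QH.q i1 i2) (∅ : Finset Ex) tr ti →
      ∃ e : Ex, ti = {e} ∧ qtw (QH.q i1 i2) tr ti = QH.gE i1 i2 e) ∧
    Function.Injective (QH.gE i1 i2) := by
  classical
  have hg : Function.Injective (QH.g i1 i2) := by
    intro v w h
    simp only [QH.g, QAtom.ba.injEq] at h
    exact Sum.inl.inj h.1
  refine ⟨hg, ?_, ?_, ?_⟩
  · intro e
    obtain ⟨tr, h1, h2⟩ := QHaux.pre i1 i2 hi hne e
    refine ⟨tr, ⟨h1, fun tr' ti' h hs => ?_⟩, h2⟩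
    exact (Finset.subset_singleton_iff.1 hs).resolve_left h.2.1.ne_empty
  · rintro tr ti ⟨h, hmin⟩
    obtain ⟨e, he⟩ := h.2.1
    obtain ⟨tr', h1, _⟩ := QHaux.pre i1 i2 hi hne e
    have hti := hmin tr' {e} h1 (Finset.singleton_subset_iff.2 he)
    subst hti
    refine ⟨e, rfl, QHaux.qtw_eq i1 i2 tr e (Finset.disjoint_singleton_right.1 h.1) ?_⟩
    intro v hv
    have hm := h.2.2.2.2.1 (QH.g i1 i2 v) (Finset.mem_image_of_mem _ (Finset.mem_univ v)) (by
      simp only [QH.g, QAtom.vars, Finset.disjoint_singleton_right, Finset.mem_insert,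
        Finset.mem_singleton, not_not]
      exact hv.imp Eq.symm Eq.symm)
    have hm2 := (Finset.mem_filter.1 hm).2.1
    simpa only [QH.g, QAtom.vars, Finset.insert_subset_iff, Finset.singleton_subset_iff,
      Finset.mem_union, Finset.mem_singleton] using hm2
  · intro e e' h
    exact hsets e e' (Finset.image_injective hg h)

end QH
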